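/- arXiv:1306.3724 — 2 statements merged into one kernel-verified Lean document; each statement's English description precedes it below -/
import Mathlib

section
/- Let (S,Σ,μ) be an atomless probability space, T a nonempty topological space, and B: F ⇉ F a decomposable μ-sequentially closed-graphed mapping on F ⊆ L(S,T). If there is a nonempty set X ⊆ F that is compact and metrizable in the topology of pointwise convergence and satisfies X ∩ B(f) ≠ ∅ for every f ∈ F, then B has a fixed point. -/
open MeasureTheory Topology Filter

/-- `pw E g f` is the decomposition `g_E f`: equal to `g` on `E` and to `f` off `E`. -/
noncomputable def pw {α β : Type*} (E : Set α) (g f : α → β) : α → β :=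
  haveI := Classical.decPred (· ∈ E)
  E.piecewise g f

/-- A set of functions `F ⊆ L(S,T)` is decomposable if it is stable under
decompositions along measurable sets. -/
def Decomposable {S T : Type*} [MeasurableSpace S] (F : Set (S → T)) : Prop :=
  ∀ f ∈ F, ∀ g ∈ F, ∀ E : Set S, MeasurableSet E → pw E g f ∈ F

/-- A measure is atomless if every measurable set of positive measure has a measurable
subset of strictly smaller positive measure. -/
def MeasureAtomless {S : Type*} [MeasurableSpace S] (μ : Measure S) : Prop :=
  ∀ E : Set S, MeasurableSet E → 0 < μ E →
    ∃ F : Set S, F ⊆ E ∧ MeasurableSet F ∧ 0 < μ F ∧ μ F < μ E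

/-- `B : F ⇉ F` is a decomposable μ-sequentially closed-graphed mapping:
the domain `F` and all values `B f` are decomposable, `B` is insensitive to
modifications on μ-null sets, `F` is sequentially closed (for the topology of
pointwise convergence) and `B` has a sequentially closed graph in `F × F`. -/
structure IsDecompSeqClosedGraph {S T : Type*} [MeasurableSpace S] [TopologicalSpace T]
    (μ : Measure S) (F : Set (S → T)) (B : (S → T) → Set (S → T)) : Prop where
  decomp_dom : Decomposable F
  maps_into : ∀ f ∈ F, B f ⊆ F
  decomp_val : ∀ f ∈ F, Decomposable (B f)
  null_modification : ∀ E : Set S, MeasurableSet E → μ E = 0 →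
    ∀ f ∈ F, ∀ g ∈ B f, ∀ h ∈ F, pw E h g ∈ B f ∧ g ∈ B (pw E h f)
  seqClosed_dom : IsSeqClosed F
  seqClosed_graph : ∀ (u v : ℕ → S → T) (f g : S → T),
    (∀ n, u n ∈ F) → (∀ n, v n ∈ B (u n)) →
    Tendsto u atTop (𝓝 f) → Tendsto v atTop (𝓝 g) →
    f ∈ F → g ∈ F → g ∈ B f

section Scarf

variable {I T V α : Type*} [LinearOrder α]

/-- A finite set `σ` is dominant for the utilities `u` if no point is strictly better than
the worst element of `σ` for every utility. -/
def Dominant (u : I → V → α) (σ : Finset V) : Prop :=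
  ∀ x, ∃ i, ∀ z ∈ σ, u i x ≤ u i z

lemma Dominant.mono {u : I → V → α} {σ τ : Finset V} (h : Dominant u σ) (hτ : τ ⊆ σ) :
    Dominant u τ := fun x ↦ (h x).imp fun _ hi z hz ↦ hi z (hτ hz)

variable [Fintype I] [DecidableEq I] [DecidableEq V]

/-- A set with as many elements as there are colors, not all colors being used,
has an even number of facets whose set of colors is `{i₀}ᶜ`. -/
lemma even_card_facets (c : V → I) (i₀ : I) (σ : Finset V) (hσ : σ.card = Fintype.card I)
    (hc : σ.image c ≠ Finset.univ) :
    Even ((σ.filter fun x ↦ (σ.erase x).image c = Finset.univ.erase i₀).card) := by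
  by_cases hne : (σ.filter fun x ↦ (σ.erase x).image c = Finset.univ.erase i₀) = ∅
  · simp [hne]
  obtain ⟨x, hx⟩ := Finset.nonempty_iff_ne_empty.mpr hne
  rw [Finset.mem_filter] at hx
  obtain ⟨hxσ, hx⟩ := hx
  have hinj : Set.InjOn c (σ.erase x : Finset V) := by
    rw [← Finset.card_image_iff, hx, Finset.card_erase_of_mem hxσ,
      Finset.card_erase_of_mem (Finset.mem_univ _), hσ, Finset.card_univ]
  have hcx : c x ≠ i₀ := by
    intro h
    apply hc
    rw [← Finset.insert_erase hxσ, Finset.image_insert, hx, h,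
      Finset.insert_erase (Finset.mem_univ _)]
  have hmem : c x ∈ (σ.erase x).image c := by rw [hx]; simp [hcx]
  obtain ⟨x', hx', hcx'⟩ := Finset.mem_image.mp hmem
  obtain ⟨hne', hx'σ⟩ := Finset.mem_erase.mp hx'
  have : (σ.filter fun x ↦ (σ.erase x).image c = Finset.univ.erase i₀) = {x, x'} := by
    ext y
    simp only [Finset.mem_filter, Finset.mem_insert, Finset.mem_singleton]
    constructor
    · rintro ⟨hy, hyc⟩
      by_contra! hcon
      have h1 : c y ∈ (σ.erase x).image c :=
        Finset.mem_image_of_mem _ (Finset.mem_erase.mpr ⟨hcon.1, hy⟩)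
      rw [hx, ← hyc] at h1
      obtain ⟨z, hz, hzy⟩ := Finset.mem_image.mp h1
      obtain ⟨hzy', hzσ⟩ := Finset.mem_erase.mp hz
      by_cases hzx : z = x
      · subst hzx
        exact hcon.2 (hinj (by simp [hcon.1, hy]) (by simp [hne', hx'σ]) (hzy.symm.trans hcx'.symm))
      · exact hzy' (hinj (by simp [hzx, hzσ]) (by simp [hcon.1, hy]) hzy)
    · rintro (rfl | rfl)
      · exact ⟨hxσ, hx⟩
      · refine ⟨hx'σ, ?_⟩
        rw [← hx]
        ext k
        simp only [Finset.mem_image, Finset.mem_erase]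
        constructor
        · rintro ⟨z, ⟨hz, hzσ⟩, rfl⟩
          by_cases hzx : z = x
          · exact ⟨y, ⟨hne', hx'σ⟩, by rw [hcx', hzx]⟩
          · exact ⟨z, ⟨hzx, hzσ⟩, rfl⟩
        · rintro ⟨z, ⟨hz, hzσ⟩, rfl⟩
          by_cases hzx : z = y
          · exact ⟨x, ⟨hne'.symm, hxσ⟩, by rw [← hcx', hzx]⟩
          · exact ⟨z, ⟨hzx, hzσ⟩, rfl⟩
  rw [this, Finset.card_pair hne'.symm]
  exact even_two

variable [Fintype V]

/-- The replacement property: a dominant set with one element less than there are utilities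
extends in exactly two ways to a dominant set with one more element, provided it is not extremal. -/
lemma Dominant.even_card_extensions {u : I → V → α} (hu : ∀ i, Function.Injective (u i))
    {τ : Finset V} (hτ : Dominant u τ) (hcard : τ.card + 1 = Fintype.card I) (hne : τ.Nonempty)
    (hQ : ∀ k, ∃ x, ∀ l ≠ k, ∃ z ∈ τ, u l z < u l x) :
    Even (Nat.card {y // y ∉ τ ∧ Dominant u (insert y τ)}) := by
  choose m hmτ hm using fun i ↦ Finset.exists_min_image τ (u i) hne
  have hm_eq : ∀ i, ∀ z ∈ τ, (∀ w ∈ τ, u i z ≤ u i w) → m i = z := fun i z hz h ↦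
    hu i (le_antisymm (hm i z hz) (h _ (hmτ i)))
  have himage : Finset.univ.image m = τ := by
    ext z
    simp only [Finset.mem_image, Finset.mem_univ, true_and]
    refine ⟨by rintro ⟨i, rfl⟩; exact hmτ i, fun hz ↦ ?_⟩
    obtain ⟨i, hi⟩ := hτ z
    exact ⟨i, hm_eq i z hz hi⟩
  obtain ⟨i, -, j, -, hij, hmij⟩ : ∃ i ∈ (Finset.univ : Finset I), ∃ j ∈ (Finset.univ : Finset I),
      i ≠ j ∧ m i = m j := by
    apply Finset.exists_ne_map_eq_of_card_lt_of_maps_to (t := τ)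
    · rw [Finset.card_univ]; omega
    · intro a _; exact hmτ a
  have hinj : ∀ i j, i ≠ j → m i = m j → Set.InjOn m {i}ᶜ := by
    intro i j hij hmij
    have h1 : (Finset.univ.erase i).image m = τ := by
      rw [← himage]
      ext z
      simp only [Finset.mem_image, Finset.mem_erase, Finset.mem_univ, and_true, true_and]
      constructor
      · rintro ⟨a, -, h⟩; exact ⟨a, h⟩
      · rintro ⟨a, h⟩
        by_cases ha : a = i
        · exact ⟨j, hij.symm, by rw [← hmij, ← ha, h]⟩
        · exact ⟨a, ha, h⟩
    have h2 : Set.InjOn m (Finset.univ.erase i : Finset I) := by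
      rw [← Finset.card_image_iff, h1, Finset.card_erase_of_mem (Finset.mem_univ _),
        Finset.card_univ]
      omega
    convert h2 using 1
    ext; simp
  have hinji := hinj i j hij hmij
  have hinjj := hinj j i hij.symm hmij.symm
  let Q : I → V → Prop := fun k x ↦ ∀ l ≠ k, u l (m l) < u l x
  let M : I → V → Prop := fun k y ↦ Q k y ∧ ∀ x, Q k x → u k x ≤ u k y
  have hMex : ∀ k, ∃ y, M k y := by
    intro k
    obtain ⟨x, hx⟩ := hQ k
    classical
    obtain ⟨y, hy, hmax⟩ := Finset.exists_max_image (Finset.univ.filter (Q k)) (u k)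
      ⟨x, by
        simp only [Finset.mem_filter, Finset.mem_univ, true_and]
        intro l hl
        obtain ⟨z, hz, hzx⟩ := hx l hl
        exact (hm l z hz).trans_lt hzx⟩
    exact ⟨y, by simpa using hy, fun x hx ↦ hmax x (by simpa using hx)⟩
  have hMuniq : ∀ k y z, M k y → M k z → y = z := fun k y z hy hz ↦
    hu k (le_antisymm (hz.2 y hy.1) (hy.2 z hz.1))
  have hle : ∀ k y, M k y → u k y ≤ u k (m k) := by
    intro k y hy
    by_contra! hlt
    obtain ⟨l, hl⟩ := hτ y
    by_cases hlk : l = k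
    · subst hlk; exact absurd (hl _ (hmτ l)) hlt.not_ge
    · exact absurd (hl _ (hmτ l)) (hy.1 l hlk).not_ge
  have hback : ∀ k k' y, k ≠ k' → m k = m k' → M k y → y ∉ τ ∧ Dominant u (insert y τ) := by
    intro k k' y hkk' hmk hy
    constructor
    · intro hyτ
      rw [← himage] at hyτ
      obtain ⟨l, -, hl⟩ := Finset.mem_image.mp hyτ
      by_cases hlk : l = k
      · have := hy.1 k' hkk'.symm
        rw [← hmk, ← hlk, hl] at this
        exact lt_irrefl _ this
      · have := hy.1 l hlk
        rw [hl] at this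
        exact lt_irrefl _ this
    · intro x
      by_contra! hcon
      have hQx : Q k x := by
        intro l hl
        obtain ⟨z, hz, hzx⟩ := hcon l
        rcases Finset.mem_insert.mp hz with rfl | hz
        · exact (hy.1 l hl).trans hzx
        · exact (hm l z hz).trans_lt hzx
      obtain ⟨z, hz, hzx⟩ := hcon k
      have h1 := hy.2 x hQx
      rcases Finset.mem_insert.mp hz with rfl | hz
      · exact absurd h1 hzx.not_ge
      · exact absurd (h1.trans ((hle k y hy).trans (hm k z hz))) hzx.not_ge
  have hforw : ∀ y, y ∉ τ → Dominant u (insert y τ) → M i y ∨ M j y := by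
    intro y hy hD
    have hmin : ∀ z ∈ τ, ∃ l, m l = z ∧ u l z < u l y := by
      intro z hz
      obtain ⟨l, hl⟩ := hD z
      refine ⟨l, hm_eq l z hz fun w hw ↦ hl w (Finset.mem_insert_of_mem hw), ?_⟩
      exact lt_of_le_of_ne (hl y (Finset.mem_insert_self _ _))
        fun h ↦ hy (hu l h ▸ hz)
    have hother : ∀ l, l ≠ i → l ≠ j → u l (m l) < u l y := by
      intro l hli hlj
      obtain ⟨l', hl', h⟩ := hmin (m l) (hmτ l)
      have : l' = l := by
        by_cases h' : l' = i
        · subst h'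
          exact hinjj (by simpa using hij) (by simpa using hlj) hl'
        · exact hinji (by simpa using h') (by simpa using hli) hl'
      rwa [this] at h
    have hone : u i (m i) < u i y ∨ u j (m j) < u j y := by
      obtain ⟨l, hl, h⟩ := hmin (m i) (hmτ i)
      by_cases hli : l = i
      · left; rwa [hli] at h
      · right
        have : l = j := hinji (by simpa using hli) (by simpa using hij.symm) (hl.trans hmij)
        rwa [← hmij, ← this]
    have hmax : ∀ k, Q k y → M k y := by
      refine fun k hk ↦ ⟨hk, fun x hx ↦ ?_⟩
      obtain ⟨l, hl⟩ := hD x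
      by_cases hlk : l = k
      · subst hlk; exact hl y (Finset.mem_insert_self _ _)
      · exact absurd (hl _ (Finset.mem_insert_of_mem (hmτ l))) (hx l hlk).not_ge
    rcases hone with h | h
    · refine Or.inr (hmax j fun l hl ↦ ?_)
      by_cases hli : l = i
      · rwa [hli]
      · exact hother l hli hl
    · refine Or.inl (hmax i fun l hl ↦ ?_)
      by_cases hlj : l = j
      · rwa [hlj]
      · exact hother l hl hlj
  obtain ⟨a, ha⟩ := hMex i
  obtain ⟨b, hb⟩ := hMex j
  have hab : a ≠ b := by
    rintro rfl
    exact absurd (hle j a hb) (ha.1 j hij.symm).not_ge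
  have hset : {y | y ∉ τ ∧ Dominant u (insert y τ)} = {a, b} := by
    ext y
    simp only [Set.mem_ofPred_eq, Set.mem_insert_iff, Set.mem_singleton_iff]
    constructor
    · rintro ⟨hy, hD⟩
      exact (hforw y hy hD).imp (fun h ↦ hMuniq i y a h ha) (fun h ↦ hMuniq j y b h hb)
    · rintro (rfl | rfl)
      · exact hback i j _ hij hmij ha
      · exact hback j i _ hij.symm hmij.symm hb
  have : Nat.card {y // y ∉ τ ∧ Dominant u (insert y τ)} = 2 := by
    change Set.ncard {y | y ∉ τ ∧ Dominant u (insert y τ)} = 2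
    rw [hset, Set.ncard_pair hab]
  rw [this]
  exact even_two

/-- Scarf's combinatorial lemma: a coloring of points, together with one extremal point for
each utility colored by that utility, has a dominant set containing all colors. -/
theorem exists_dominant_image_eq_univ [Fintype T] [Nonempty T] [Nonempty I] [DecidableEq T]
    {u : I → T ⊕ I → α}
    (hu : ∀ i, Function.Injective (u i)) (hmin : ∀ i x, u i (Sum.inr i) ≤ u i x)
    (hmax : ∀ i j t, i ≠ j → u i (Sum.inl t) < u i (Sum.inr j)) (c : T → I) :
    ∃ σ : Finset (T ⊕ I), Dominant u σ ∧ σ.image (Sum.elim c id) = Finset.univ := by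
  classical
  by_contra! hcon
  obtain ⟨i₀⟩ := ‹Nonempty I›
  set c' : T ⊕ I → I := Sum.elim c id with hc'
  let R : Finset (Finset (T ⊕ I)) :=
    Finset.univ.filter fun σ ↦ σ.card = Fintype.card I ∧ Dominant u σ
  let D : Finset (Finset (T ⊕ I)) :=
    Finset.univ.filter fun τ ↦ τ.card + 1 = Fintype.card I ∧ Dominant u τ ∧
      τ.image c' = Finset.univ.erase i₀
  let P := R.sigma fun σ ↦ σ.filter fun x ↦ (σ.erase x).image c' = Finset.univ.erase i₀
  let P' := D.sigma fun τ ↦ Finset.univ.filter fun y ↦ y ∉ τ ∧ Dominant u (insert y τ)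
  have hPP' : P.card = P'.card := by
    refine Finset.card_bij' (fun p _ ↦ ⟨p.1.erase p.2, p.2⟩) (fun p _ ↦ ⟨insert p.2 p.1, p.2⟩)
      ?_ ?_ ?_ ?_
    · rintro ⟨σ, x⟩ h
      simp only [P, R, Finset.mem_sigma, Finset.mem_filter, Finset.mem_univ, true_and] at h
      obtain ⟨⟨h1, h2⟩, h3, h4⟩ := h
      simp only [P', D, Finset.mem_sigma, Finset.mem_filter, Finset.mem_univ, true_and]
      refine ⟨⟨?_, h2.mono (Finset.erase_subset _ _), h4⟩, by simp, ?_⟩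
      · rw [← h1, Finset.card_erase_add_one h3]
      · rwa [Finset.insert_erase h3]
    · rintro ⟨τ, y⟩ h
      simp only [P', D, Finset.mem_sigma, Finset.mem_filter, Finset.mem_univ, true_and] at h
      obtain ⟨⟨h1, h2, h3⟩, h4, h5⟩ := h
      simp only [P, R, Finset.mem_sigma, Finset.mem_filter, Finset.mem_univ, true_and]
      refine ⟨⟨?_, h5⟩, by simp, ?_⟩
      · rw [← h1, Finset.card_insert_of_notMem h4]
      · rwa [Finset.erase_insert h4]
    · rintro ⟨σ, x⟩ h
      simp only [P, R, Finset.mem_sigma, Finset.mem_filter, Finset.mem_univ, true_and] at h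
      simp [Finset.insert_erase h.2.1]
    · rintro ⟨τ, y⟩ h
      simp only [P', D, Finset.mem_sigma, Finset.mem_filter, Finset.mem_univ, true_and] at h
      simp [Finset.erase_insert h.2.1]
  have hP : Even P.card := by
    rw [Finset.card_sigma]
    refine Finset.even_sum _ fun σ hσ ↦ ?_
    simp only [R, Finset.mem_filter, Finset.mem_univ, true_and] at hσ
    exact even_card_facets c' i₀ σ hσ.1 (hcon σ hσ.2)
  let τ₀ : Finset (T ⊕ I) := (Finset.univ.erase i₀).image Sum.inr
  obtain ⟨t₀, -, ht₀⟩ := Finset.exists_max_image (Finset.univ : Finset T)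
    (fun t ↦ u i₀ (Sum.inl t)) Finset.univ_nonempty
  have hdom₀ : Dominant u (insert (Sum.inl t₀) τ₀) := by
    rintro (t | i)
    · refine ⟨i₀, fun z hz ↦ ?_⟩
      rcases Finset.mem_insert.mp hz with rfl | hz
      · exact ht₀ t (Finset.mem_univ _)
      · obtain ⟨j, hj, rfl⟩ := Finset.mem_image.mp hz
        exact (hmax i₀ j t (Finset.ne_of_mem_erase hj).symm).le
    · exact ⟨i, fun z _ ↦ hmin i z⟩
  have hτ₀D : τ₀ ∈ D := by
    simp only [D, Finset.mem_filter, Finset.mem_univ, true_and]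
    refine ⟨?_, hdom₀.mono (Finset.subset_insert _ _), ?_⟩
    · rw [Finset.card_image_of_injective _ Sum.inr_injective,
        Finset.card_erase_add_one (Finset.mem_univ _), Finset.card_univ]
    · simp only [τ₀, Finset.image_image]
      exact Finset.image_id
  have hext₀ : (Finset.univ.filter fun y ↦ y ∉ τ₀ ∧ Dominant u (insert y τ₀)) = {Sum.inl t₀} := by
    ext y
    simp only [Finset.mem_filter, Finset.mem_univ, true_and, Finset.mem_singleton]
    constructor
    · rintro ⟨hy, hD⟩
      obtain ⟨i, hi⟩ := hD (Sum.inl t₀)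
      have hii : i = i₀ := by
        by_contra hne
        have hmem : (Sum.inr i : T ⊕ I) ∈ τ₀ :=
          Finset.mem_image_of_mem _ (Finset.mem_erase.mpr ⟨hne, Finset.mem_univ _⟩)
        have := (hi _ (Finset.mem_insert_of_mem hmem)).antisymm (hmin i _)
        exact Sum.inl_ne_inr (hu i this)
      subst hii
      rcases y with t | j
      · exact hu i (le_antisymm (ht₀ t (Finset.mem_univ _)) (hi _ (Finset.mem_insert_self _ _)))
      · exfalso
        by_cases hj : j = i
        · subst hj
          have := (hi _ (Finset.mem_insert_self _ _)).antisymm (hmin j _)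
          exact Sum.inl_ne_inr (hu j this)
        · exact hy (Finset.mem_image_of_mem _ (Finset.mem_erase.mpr ⟨hj, Finset.mem_univ _⟩))
    · rintro rfl
      exact ⟨by simp [τ₀], hdom₀⟩
  have hP' : Odd P'.card := by
    rw [Finset.card_sigma, ← Finset.add_sum_erase _ _ hτ₀D, hext₀, Finset.card_singleton]
    refine odd_one.add_even (Finset.even_sum _ fun τ hτ ↦ ?_)
    obtain ⟨hττ₀, hτ⟩ := Finset.mem_erase.mp hτ
    simp only [D, Finset.mem_filter, Finset.mem_univ, true_and] at hτ
    obtain ⟨h1, h2, h3⟩ := hτ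
    have hex : ∃ t, Sum.inl t ∈ τ := by
      by_contra! hno
      apply hττ₀
      ext z
      rcases z with t | i
      · simp [hno t, τ₀]
      · have hi : i ∈ τ.image c' ↔ Sum.inr i ∈ τ := by
          rw [Finset.mem_image]
          constructor
          · rintro ⟨t | j, hz, rfl⟩
            · exact absurd hz (hno t)
            · exact hz
          · exact fun h ↦ ⟨_, h, rfl⟩
        rw [← hi, h3]
        simp [τ₀]
    obtain ⟨t, ht⟩ := hex
    have := h2.even_card_extensions hu h1 ⟨_, ht⟩
      fun k ↦ ⟨Sum.inr k, fun l hl ↦ ⟨_, ht, hmax l k t hl⟩⟩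
    rwa [Nat.card_eq_fintype_card, Fintype.card_subtype] at this
  rw [hPP'] at hP
  exact (Nat.not_even_iff_odd.mpr hP') hP

/-- A version of Scarf's lemma with possibly non-injective utilities. -/
theorem exists_finset_forall_exists_mem_image [Fintype T] [Nonempty T] [Nonempty I]
    (v : I → T → ℕ) (c : T → I) :
    ∃ σ : Finset T, ∀ x, ∃ i ∈ c '' σ, ∀ a ∈ σ, v i x ≤ v i a := by
  classical
  let B : ℕ := ∑ i, ∑ t, v i t
  have hB : ∀ i t, v i t ≤ B := fun i t ↦
    (Finset.single_le_sum (f := fun t ↦ v i t) (fun _ _ ↦ Nat.zero_le _)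
      (Finset.mem_univ t)).trans
      (Finset.single_le_sum (f := fun i ↦ ∑ t, v i t) (fun _ _ ↦ Nat.zero_le _)
        (Finset.mem_univ i))
  let eT := Fintype.equivFin T
  let eI := Fintype.equivFin I
  let u : I → T ⊕ I → ℕ ×ₗ ℕ := fun i ↦ Sum.elim (fun t ↦ toLex (v i t + 1, (eT t : ℕ)))
    fun j ↦ if i = j then toLex (0, 0) else toLex (B + 2, (eI j : ℕ))
  have hu : ∀ i, Function.Injective (u i) := by
    rintro i (t | j) (t' | j') h
    · simp only [u, Sum.elim_inl, toLex_inj, Prod.mk.injEq] at h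
      rw [eT.injective (Fin.ext h.2)]
    · have := hB i t
      simp only [u, Sum.elim_inl, Sum.elim_inr] at h
      split_ifs at h <;> simp only [toLex_inj, Prod.mk.injEq] at h <;> omega
    · have := hB i t'
      simp only [u, Sum.elim_inl, Sum.elim_inr] at h
      split_ifs at h <;> simp only [toLex_inj, Prod.mk.injEq] at h <;> omega
    · simp only [u, Sum.elim_inr] at h
      split_ifs at h with h1 h2 h2
      · rw [← h1, ← h2]
      · simp at h
      · simp at h
      · simp only [toLex_inj, Prod.mk.injEq] at h
        rw [eI.injective (Fin.ext h.2)]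
  have hmin : ∀ i x, u i (Sum.inr i) ≤ u i x := by
    rintro i (t | j)
    · simp [u, Prod.Lex.toLex_le_toLex]
    · by_cases h : i = j <;> simp [u, Prod.Lex.toLex_le_toLex, h]
  have hmax : ∀ i j t, i ≠ j → u i (Sum.inl t) < u i (Sum.inr j) := by
    intro i j t hij
    have := hB i t
    simp only [u, Sum.elim_inl, Sum.elim_inr, hij, if_false, Prod.Lex.toLex_lt_toLex]
    omega
  obtain ⟨σ, hσ, hc⟩ := exists_dominant_image_eq_univ hu hmin hmax c
  refine ⟨Finset.univ.filter fun t ↦ Sum.inl t ∈ σ, fun x ↦ ?_⟩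
  obtain ⟨i, hi⟩ := hσ (Sum.inl x)
  refine ⟨i, ?_, fun a ha ↦ ?_⟩
  · have hmem : i ∈ σ.image (Sum.elim c id) := hc ▸ Finset.mem_univ i
    obtain ⟨t | j, hz, hzi⟩ := Finset.mem_image.mp hmem
    · exact ⟨t, by simpa using hz, hzi⟩
    · have := hi _ hz
      simp only [Sum.elim_inr, id] at hzi
      subst hzi
      simp [u, Prod.Lex.toLex_le_toLex] at this
  · have := hi (Sum.inl a) (by simpa using ha)
    simp only [u, Sum.elim_inl, Prod.Lex.toLex_le_toLex] at this
    omega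

end Scarf

section StepFunctions

variable {I : Type*} [Fintype I]

lemma exists_colorful_compositions [Nonempty I] (N : ℕ) (c : (I → ℕ) → I) :
    ∃ (C : Finset I) (m : I → ℕ) (w : I → I → ℕ), C.Nonempty ∧ N < ∑ i ∈ C, (m i + 1) ∧
      ∀ i ∈ C, ∑ j, w i j = N ∧ c (w i) = i ∧ m ≤ w i := by
  classical
  have hmem : ∀ a : I → ℕ, a ∈ Finset.piAntidiag Finset.univ N ↔ ∑ j, a j = N := by
    simp [Finset.mem_piAntidiag]
  let T := ↥(Finset.piAntidiag (Finset.univ : Finset I) N)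
  obtain ⟨k⟩ := ‹Nonempty I›
  have single : ∀ b : I → ℕ, ∑ j, b j ≤ N → ∃ a : T, b ≤ a.1 := by
    intro b hb
    refine ⟨⟨b + Pi.single k (N - ∑ j, b j), (hmem _).mpr ?_⟩, le_self_add⟩
    simp only [Pi.add_apply, Finset.sum_add_distrib, Finset.sum_pi_single', Finset.mem_univ,
      if_true]
    omega
  obtain ⟨a₀, -⟩ := single 0 (by simp)
  have : Nonempty T := ⟨a₀⟩
  have : Nonempty I := ⟨k⟩
  obtain ⟨σ, hσ⟩ := exists_finset_forall_exists_mem_image (T := T) (fun i a ↦ a.1 i)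
    fun a ↦ c a.1
  have hne : σ.Nonempty := by
    obtain ⟨i, ⟨a, ha, -⟩, -⟩ := hσ a₀
    exact ⟨a, ha⟩
  choose w hwσ hw using fun i ↦ Finset.exists_min_image σ (fun a ↦ a.1 i) hne
  have hC : ∀ i ∈ σ.image fun a ↦ c a.1, ∃ a ∈ σ, c a.1 = i := fun i hi ↦ by simpa using hi
  choose! z hzσ hz using hC
  refine ⟨σ.image fun a ↦ c a.1, fun i ↦ (w i).1 i, fun i ↦ (z i).1, hne.image _, ?_, ?_⟩
  · by_contra! hcon
    obtain ⟨a, ha⟩ := single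
      (fun i ↦ if i ∈ σ.image (fun a ↦ c a.1) then (w i).1 i + 1 else 0) (by
        rwa [Finset.sum_ite_mem, Finset.univ_inter])
    obtain ⟨i, ⟨b, hb, hbi⟩, hi⟩ := hσ a
    have h1 := hi (w i) (hwσ i)
    have h2 := ha i
    have h3 : i ∈ σ.image fun a ↦ c a.1 := Finset.mem_image.mpr ⟨b, hb, hbi⟩
    simp only [h3, if_true] at h2
    omega
  · exact fun i hi ↦ ⟨(hmem _).mp (z i).2, hz i hi, fun j ↦ hw j _ (hzσ i hi)⟩

variable [LinearOrder I]

/-- The sorted word of length `N` in which the letter `i` appears `a i` times. -/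
lemma exists_sorted_word [Nonempty I] (N : ℕ) :
    ∃ W : (I → ℕ) → ℕ → I, ∀ a, ∑ j, a j = N → ∀ m < N,
      ∀ i, W a m ≤ i ↔ m < ∑ j with j ≤ i, a j := by
  have : ∀ (a : I → ℕ) (m : ℕ), ∃ i₀, ∑ j, a j = N → m < N →
      ∀ i, i₀ ≤ i ↔ m < ∑ j with j ≤ i, a j := by
    intro a m
    by_cases h : ∑ j, a j = N ∧ m < N
    swap
    · exact ⟨Classical.arbitrary I, fun h1 h2 ↦ absurd ⟨h1, h2⟩ h⟩
    obtain ⟨k, -, hk⟩ := Finset.exists_max_image (Finset.univ : Finset I) id Finset.univ_nonempty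
    obtain ⟨i₀, hi₀, hmin⟩ := Finset.exists_min_image
      (Finset.univ.filter fun i ↦ m < ∑ j with j ≤ i, a j) id ⟨k, by
        simp only [Finset.mem_filter, Finset.mem_univ, true_and]
        rw [Finset.filter_true_of_mem fun j hj ↦ by simpa using hk j hj, h.1]
        exact h.2⟩
    simp only [Finset.mem_filter, Finset.mem_univ, true_and, id] at hi₀ hmin
    refine ⟨i₀, fun _ _ i ↦ ⟨fun hi ↦ hi₀.trans_le ?_, hmin i⟩⟩
    exact Finset.sum_le_sum_of_subset fun j hj ↦ by
      simp only [Finset.mem_filter, Finset.mem_univ, true_and] at hj ⊢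
      exact hj.trans hi
  choose W hW using this
  exact ⟨W, fun a ha m hm ↦ hW a m ha hm⟩

lemma card_filter_word_eq_le {N : ℕ} {a : I → ℕ} {W : ℕ → I}
    (hW : ∀ m < N, ∀ i, W m ≤ i ↔ m < ∑ j with j ≤ i, a j) (i : I) :
    ((Finset.range N).filter fun m ↦ W m = i).card ≤ a i := by
  have hsplit : ∑ j with j ≤ i, a j = ∑ j with j < i, a j + a i := by
    have : (Finset.univ.filter fun j ↦ j ≤ i) = insert i (Finset.univ.filter fun j ↦ j < i) := by
      ext j; simp [le_iff_eq_or_lt]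
    rw [this, Finset.sum_insert (by simp), add_comm]
  have hsub : ((Finset.range N).filter fun m ↦ W m = i) ⊆
      Finset.Ico (∑ j with j < i, a j) (∑ j with j ≤ i, a j) := by
    intro m hm
    simp only [Finset.mem_filter, Finset.mem_range] at hm
    obtain ⟨hmN, rfl⟩ := hm
    refine Finset.mem_Ico.mpr ⟨?_, (hW m hmN _).mp le_rfl⟩
    by_cases hne : (Finset.univ.filter fun j ↦ j < W m).Nonempty
    · obtain ⟨k, hk, hmax⟩ := Finset.exists_max_image _ id hne
      simp only [Finset.mem_filter, Finset.mem_univ, true_and, id] at hk hmax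
      have : (Finset.univ.filter fun j ↦ j < W m) = Finset.univ.filter fun j ↦ j ≤ k := by
        ext j
        simp only [Finset.mem_filter, Finset.mem_univ, true_and]
        exact ⟨hmax j, fun h ↦ h.trans_lt hk⟩
      rw [this]
      exact not_lt.mp fun h ↦ hk.not_ge ((hW m hmN k).mpr h)
    · rw [Finset.not_nonempty_iff_eq_empty.mp hne]
      simp
  calc _ ≤ _ := Finset.card_le_card hsub
    _ = a i := by rw [Nat.card_Ico, hsplit]; omega

/-- Approximate fixed words: for every coloring `c` of sorted words there is a word `b` such that
every subword of `b` of length `card I` contains the color of some word close to `b`. -/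
lemma exists_word_approx [Nonempty I] (N : ℕ) (W : (I → ℕ) → ℕ → I)
    (hW : ∀ a, ∑ j, a j = N → ∀ m < N, ∀ i, W a m ≤ i ↔ m < ∑ j with j ≤ i, a j)
    (c : (I → ℕ) → I) :
    ∃ b, ∑ j, b j = N ∧ ∀ m, m + Fintype.card I ≤ N →
      ∃ a, ∑ j, a j = N ∧
        (∃ m', m ≤ m' ∧ m' < m + Fintype.card I ∧ W b m' = c a) ∧
        ∀ m, m + Fintype.card I < N →
          W a m ≤ W b (m + Fintype.card I) ∧ W b m ≤ W a (m + Fintype.card I) := by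
  obtain ⟨C, p, w, ⟨i₀, hi₀⟩, hlt, hw⟩ := exists_colorful_compositions N c
  have hCcard : C.card ≤ Fintype.card I := Finset.card_le_univ C
  rw [Finset.sum_add_distrib, Finset.sum_const, smul_eq_mul, mul_one] at hlt
  have hpC : ∑ i ∈ C, p i ≤ ∑ i, p i := Finset.sum_le_sum_of_subset (Finset.subset_univ _)
  have hcum : ∀ i ∈ C, ∀ j, ∑ k with k ≤ j, p k ≤ ∑ k with k ≤ j, w i k ∧
      ∑ k with k ≤ j, w i k ≤ ∑ k with k ≤ j, p k + Fintype.card I := by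
    intro i hi j
    obtain ⟨h1, -, h3⟩ := hw i hi
    have h4 := Finset.sum_le_sum fun k (_ : k ∈ Finset.univ.filter fun k ↦ k ≤ j) ↦ h3 k
    have h5 := Finset.sum_le_sum fun k (_ : k ∈ Finset.univ.filter fun k ↦ ¬ k ≤ j) ↦ h3 k
    have h6 := Finset.sum_filter_add_sum_filter_not Finset.univ (fun k ↦ k ≤ j) (w i)
    have h7 := Finset.sum_filter_add_sum_filter_not Finset.univ (fun k ↦ k ≤ j) p
    omega
  obtain ⟨hb, -, hpb⟩ := hw i₀ hi₀
  refine ⟨w i₀, hb, fun m hm ↦ ?_⟩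
  obtain ⟨m', hm', hm'2, hm'C⟩ :
      ∃ m', m ≤ m' ∧ m' < m + Fintype.card I ∧ W (w i₀) m' ∈ C := by
    by_contra! hcon
    have hsub : Finset.Ico m (m + Fintype.card I) ⊆
        Cᶜ.biUnion fun i ↦ (Finset.range N).filter fun m ↦ W (w i₀) m = i := by
      intro m' hm'
      obtain ⟨h1, h2⟩ := Finset.mem_Ico.mp hm'
      simp only [Finset.mem_biUnion, Finset.mem_compl, Finset.mem_filter, Finset.mem_range]
      exact ⟨_, hcon m' h1 h2, by omega, rfl⟩
    have h1 := (Finset.card_le_card hsub).trans (Finset.card_biUnion_le.trans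
      (Finset.sum_le_sum fun i _ ↦ card_filter_word_eq_le (hW _ hb) i))
    have h2 := Finset.sum_add_sum_compl C (w i₀)
    have h3 := Finset.sum_le_sum fun k (_ : k ∈ C) ↦ hpb k
    rw [Nat.card_Ico] at h1
    omega
  obtain ⟨ha, hca, -⟩ := hw _ hm'C
  refine ⟨w (W (w i₀) m'), ha, ⟨m', hm', hm'2, hca.symm⟩, fun m hm ↦ ⟨?_, ?_⟩⟩
  · rw [hW _ ha m (by omega)]
    have h1 := (hW _ hb _ hm _).mp le_rfl
    have h2 := (hcum _ hi₀ (W (w i₀) (m + Fintype.card I))).2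
    have h3 := (hcum _ hm'C (W (w i₀) (m + Fintype.card I))).1
    omega
  · rw [hW _ hb m (by omega)]
    have h1 := (hW _ ha _ hm _).mp le_rfl
    have h2 := (hcum _ hi₀ (W (w (W (w i₀) m')) (m + Fintype.card I))).1
    have h3 := (hcum _ hm'C (W (w (W (w i₀) m')) (m + Fintype.card I))).2
    omega

end StepFunctions

/-- Approximate fixed points for relations between monotone functions and points
of a compact set of reals. -/
theorem exists_monotone_approx {K : Set ℝ} (hK : IsCompact K) (hKne : K.Nonempty)
    (P : (ℝ → ℝ) → ℝ → Prop)
    (hP : ∀ q : ℝ → ℝ, Monotone q → (∀ t, q t ∈ K) → ∃ y ∈ K, P q y) {ε : ℝ} (hε : 0 < ε) :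
    ∃ q : ℝ → ℝ, Monotone q ∧ (∀ t, q t ∈ K) ∧ ∀ t, 0 < t → t + ε < 1 →
      ∃ r : ℝ → ℝ, Monotone r ∧ (∀ t, r t ∈ K) ∧
        (∀ s, ε < s → s + ε < 1 → q (s - ε) ≤ r s ∧ r s ≤ q (s + ε)) ∧
        ∃ y ∈ K, P r y ∧ q t - ε ≤ y ∧ y ≤ q (t + ε) + ε := by
  obtain ⟨Z, hZK, hZfin, hZ⟩ := hK.finite_cover_balls hε
  have : Fintype Z := hZfin.fintype
  obtain ⟨y₀, hy₀⟩ := hKne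
  have hnear : ∀ y ∈ K, ∃ z : Z, |y - z| < ε := by
    intro y hy
    obtain ⟨z, hz, hyz⟩ := Set.mem_iUnion₂.mp (hZ hy)
    exact ⟨⟨z, hz⟩, by rwa [Metric.mem_ball, Real.dist_eq] at hyz⟩
  have : Nonempty Z := ⟨(hnear y₀ hy₀).choose⟩
  set n := Fintype.card Z with hn
  obtain ⟨N, hN⟩ := exists_nat_gt (n / ε)
  have hnpos : 0 < n := Fintype.card_pos
  have hN' : (n : ℝ) < ε * N := by rwa [div_lt_iff₀ hε, mul_comm] at hN
  have hNpos : 0 < N := by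
    rcases Nat.eq_zero_or_pos N with h | h
    · rw [h] at hN'
      simp only [Nat.cast_zero, mul_zero] at hN'
      exact absurd hN' (Nat.cast_nonneg n).not_gt
    · exact h
  obtain ⟨W, hW⟩ := exists_sorted_word (I := Z) N
  let q : (Z → ℕ) → ℝ → ℝ := fun a t ↦ W a (min ⌊t * N⌋₊ (N - 1))
  have hqK : ∀ a t, q a t ∈ K := fun a t ↦ hZK (W a _).2
  have hWmono : ∀ a, ∑ j, a j = N → ∀ m m', m ≤ m' → m' < N → W a m ≤ W a m' := by
    intro a ha m m' hmm' hm'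
    rw [hW a ha m (by omega)]
    exact hmm'.trans_lt ((hW a ha m' hm' _).mp le_rfl)
  have hqmono : ∀ a, ∑ j, a j = N → Monotone (q a) := by
    intro a ha s t hst
    refine hWmono a ha _ _ (min_le_min_right _ (Nat.floor_le_floor ?_)) (by omega)
    gcongr
  choose! y hyK hy using fun a (ha : ∑ j, a j = N) ↦ hP (q a) (hqmono a ha) (hqK a)
  choose! c hc using hnear
  obtain ⟨b, hb, h⟩ := exists_word_approx N W hW fun a ↦ c (y a)
  have hq : ∀ a t, t < 1 → q a t = W a ⌊t * N⌋₊ ∧ ⌊t * N⌋₊ < N := by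
    intro a t ht
    have : ⌊t * N⌋₊ < N := by
      rw [Nat.floor_lt' hNpos.ne']
      have : (0 : ℝ) < N := by exact_mod_cast hNpos
      nlinarith
    exact ⟨by simp only [q]; rw [min_eq_left (by omega)], this⟩
  have hshift : ∀ t : ℝ, 0 ≤ t → ⌊t * N⌋₊ + n ≤ ⌊(t + ε) * N⌋₊ := by
    intro t ht
    rw [← Nat.floor_add_natCast (by positivity)]
    apply Nat.floor_le_floor
    nlinarith
  refine ⟨q b, hqmono b hb, hqK b, fun t ht ht1 ↦ ?_⟩
  obtain ⟨htq, -⟩ := hq b t (by linarith)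
  obtain ⟨htq', htN⟩ := hq b (t + ε) ht1
  have hsh := hshift t ht.le
  obtain ⟨a, ha, ⟨m', hm', hm'2, hWm'⟩, hclose⟩ := h ⌊t * N⌋₊ (by omega)
  refine ⟨q a, hqmono a ha, hqK a, fun s hs hs1 ↦ ⟨?_, ?_⟩, y a, hyK a ha, hy a ha, ?_⟩
  · have h1 := hshift (s - ε) (by linarith)
    rw [sub_add_cancel] at h1
    rw [(hq b (s - ε) (by linarith)).1, (hq a s (by linarith)).1]
    have h2 := (hq a s (by linarith)).2
    exact ((hclose _ (by omega)).2).trans (hWmono a ha _ _ h1 h2)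
  · have h1 := hshift s (by linarith)
    rw [(hq b (s + ε) (by linarith)).1, (hq a s (by linarith)).1]
    have h2 := (hq b (s + ε) (by linarith)).2
    exact ((hclose _ (by omega)).1).trans (hWmono b hb _ _ h1 h2)
  · have h1 := abs_lt.mp (hc (y a) (hyK a ha))
    rw [← hWm'] at h1
    have h2 : q b t ≤ W b m' := by
      rw [htq]; exact hWmono b hb _ _ hm' (by omega)
    have h3 : (W b m' : ℝ) ≤ q b (t + ε) := by
      rw [htq']; exact hWmono b hb _ _ (by omega) htN
    constructor <;> linarith

section Atomless

variable {S : Type*} [MeasurableSpace S] {μ : Measure S} [IsProbabilityMeasure μ]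

lemma MeasureAtomless.exists_subset_le (hμ : MeasureAtomless μ) {E : Set S}
    (hE : MeasurableSet E) (hE0 : 0 < μ E) (n : ℕ) :
    ∃ F ⊆ E, MeasurableSet F ∧ 0 < μ F ∧ μ F ≤ μ E / 2 ^ n := by
  induction n with
  | zero => exact ⟨E, subset_rfl, hE, hE0, by simp⟩
  | succ n ih =>
    obtain ⟨F, hFE, hF, hF0, hFn⟩ := ih
    obtain ⟨G, hGF, hG, hG0, hGF'⟩ := hμ F hF hF0
    have hadd : μ G + μ (F \ G) = μ F := by
      rw [measure_sdiff hGF hG.nullMeasurableSet (measure_ne_top _ _),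
        add_tsub_cancel_of_le hGF'.le]
    have hdiv : μ F / 2 ≤ μ E / 2 ^ (n + 1) := by
      rw [pow_succ, ENNReal.div_eq_inv_mul, ENNReal.div_eq_inv_mul,
        ENNReal.mul_inv (by simp) (by simp), mul_comm (_ ^ _)⁻¹, mul_assoc,
        ← ENNReal.div_eq_inv_mul (a := μ E)]
      gcongr
    by_cases h : μ G ≤ μ F / 2
    · exact ⟨G, hGF.trans hFE, hG, hG0, h.trans hdiv⟩
    · refine ⟨F \ G, Set.sdiff_subset.trans hFE, hF.diff hG, ?_, le_trans ?_ hdiv⟩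
      · rw [pos_iff_ne_zero]
        intro h0
        rw [h0, add_zero] at hadd
        exact hGF'.ne hadd
      · by_contra! hcon
        have := ENNReal.add_lt_add (not_le.mp h) hcon
        rw [hadd, ENNReal.add_halves] at this
        exact lt_irrefl _ this

/-- An atomless probability space has countable measurable partitions into small sets. -/
lemma MeasureAtomless.exists_partition (hμ : MeasureAtomless μ) (n : ℕ) :
    ∃ φ : S → ℕ, Measurable φ ∧ ∀ i, μ (φ ⁻¹' {i}) ≤ 1 / 2 ^ n := by
  have hgood : ∃ A : ℕ → Set S, (∀ k, MeasurableSet (A k) ∧ μ (A k) ≤ 1 / 2 ^ n) ∧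
      μ (⋃ k, A k)ᶜ = 0 := by
    let 𝒞 : Set (ℕ → Set S) := {A | ∀ k, MeasurableSet (A k) ∧ μ (A k) ≤ 1 / 2 ^ n}
    let v : Set ENNReal := (fun A ↦ μ (⋃ k, A k)) '' 𝒞
    have hne : v.Nonempty := ⟨_, fun _ ↦ ∅, fun _ ↦ by simp, rfl⟩
    obtain ⟨w, -, hw, hwv⟩ := exists_seq_tendsto_sSup hne (OrderTop.bddAbove v)
    choose A hA hAw using hwv
    let A' : ℕ → Set S := fun k ↦ A k.unpair.1 k.unpair.2
    have hA' : A' ∈ 𝒞 := fun k ↦ hA _ _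
    have hsup : sSup v ≤ μ (⋃ k, A' k) := by
      refine le_of_tendsto' hw fun k ↦ ?_
      rw [← hAw]
      refine measure_mono (Set.iUnion_subset fun j ↦ ?_)
      refine Set.subset_iUnion_of_subset (Nat.pair k j) ?_
      simp [A']
    refine ⟨A', hA', ?_⟩
    by_contra hpos
    have hmeas : MeasurableSet (⋃ k, A' k) := .iUnion fun k ↦ (hA' k).1
    obtain ⟨F, hF, hFm, hF0, hFn⟩ :=
      hμ.exists_subset_le hmeas.compl (pos_iff_ne_zero.mpr hpos) n
    let A'' : ℕ → Set S := fun k ↦ Nat.casesOn k F A'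
    have hA'' : A'' ∈ 𝒞 := by
      rintro (- | k)
      · exact ⟨hFm, hFn.trans (ENNReal.div_le_div_right prob_le_one _)⟩
      · exact hA' k
    have h1 : F ∪ ⋃ k, A' k ⊆ ⋃ k, A'' k :=
      Set.union_subset (Set.subset_iUnion A'' 0)
        (Set.iUnion_subset fun k ↦ Set.subset_iUnion A'' (k + 1))
    have h2 : μ (⋃ k, A'' k) ≤ sSup v := le_sSup ⟨A'', hA'', rfl⟩
    have h3 := (measure_mono (μ := μ) h1).trans (h2.trans hsup)
    rw [measure_union (Set.disjoint_left.mpr fun x hx ↦ hF hx) hmeas] at h3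
    exact (ENNReal.lt_add_right (measure_ne_top μ _) hF0.ne').not_ge (by rwa [add_comm] at h3)
  obtain ⟨A, hA, hA0⟩ := hgood
  classical
  let φ : S → ℕ := fun s ↦ if h : ∃ k, s ∈ A k then Nat.find h + 1 else 0
  have hφ0 : φ ⁻¹' {0} = (⋃ k, A k)ᶜ := by
    ext s
    by_cases h : ∃ k, s ∈ A k
    · simp only [φ, Set.mem_preimage, h, Set.mem_singleton_iff, dif_pos, Set.mem_compl_iff,
        Set.mem_iUnion]
      simp
    · push Not at h
      simp [φ, h]
  have hφs : ∀ k, φ ⁻¹' {k + 1} = A k \ ⋃ j < k, A j := by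
    intro k
    ext s
    by_cases h : ∃ k, s ∈ A k
    · simp only [φ, Set.mem_preimage, h, Set.mem_singleton_iff, dif_pos, Set.mem_sdiff,
        Set.mem_iUnion, add_left_inj, Nat.find_eq_iff]
      simp
    · simp only [φ, Set.mem_preimage, h, Set.mem_singleton_iff, Set.mem_sdiff]
      push Not at h
      simp [h k]
  refine ⟨φ, measurable_to_countable' ?_, ?_⟩
  · rintro (- | k)
    · rw [hφ0]; exact (MeasurableSet.iUnion fun k ↦ (hA k).1).compl
    · rw [hφs]
      exact (hA k).1.diff (.iUnion fun j ↦ .iUnion fun _ ↦ (hA j).1)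
  · rintro (- | k)
    · rw [hφ0, hA0]; exact zero_le
    · rw [hφs]
      exact (measure_mono Set.sdiff_subset).trans (hA k).2

/-- An atomless probability space carries a `(0, 1)`-valued random variable
with null fibres. -/
lemma MeasureAtomless.exists_measurable_null_fibres (hμ : MeasureAtomless μ) :
    ∃ U : S → ℝ, Measurable U ∧ (∀ s, U s ∈ Set.Ioo 0 1) ∧ ∀ t, μ (U ⁻¹' {t}) = 0 := by
  choose φ hφ hφμ using hμ.exists_partition
  let Φ : S → ℕ → ℕ := fun s n ↦ φ n s
  have hΦ : Measurable Φ := measurable_pi_lambda _ hφ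
  have he := measurableEmbedding_embeddingReal (ℕ → ℕ)
  refine ⟨fun s ↦ Real.sigmoid (embeddingReal (ℕ → ℕ) (Φ s)), ?_, ?_, ?_⟩
  · exact Real.sigmoid_monotone.measurable.comp (he.measurable.comp hΦ)
  · exact fun s ↦ ⟨Real.sigmoid_pos _, Real.sigmoid_lt_one _⟩
  · intro t
    rcases Set.eq_empty_or_nonempty
      ((fun s ↦ Real.sigmoid (embeddingReal (ℕ → ℕ) (Φ s))) ⁻¹' {t}) with h | ⟨s₀, hs₀⟩
    · rw [h, measure_empty]
    · have hle : ∀ n : ℕ, μ ((fun s ↦ Real.sigmoid (embeddingReal (ℕ → ℕ) (Φ s))) ⁻¹' {t}) ≤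
          (2⁻¹ : ENNReal) ^ n := by
        intro n
        rw [← ENNReal.inv_pow, ← one_div]
        refine (measure_mono fun s hs ↦ ?_).trans (hφμ n (φ n s₀))
        have h1 := he.injective (Real.sigmoid_injective (Eq.trans hs hs₀.symm))
        exact congrFun h1 n
      refine le_antisymm (ge_of_tendsto' (ENNReal.tendsto_pow_atTop_nhds_zero_of_lt_one ?_) hle)
        zero_le
      simp

end Atomless

/-- Helly's selection principle for monotone functions with values in a compact set. -/
lemma exists_subseq_tendsto_of_monotone {K : Set ℝ} (hK : IsCompact K) {q : ℕ → ℝ → ℝ}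
    (hq : ∀ k, Monotone (q k)) (hqK : ∀ k t, q k t ∈ K) :
    ∃ (p : ℝ → ℝ) (φ : ℕ → ℕ), Monotone p ∧ (∀ t, p t ∈ K) ∧ StrictMono φ ∧
      ∀ r : ℚ, Tendsto (fun k ↦ q (φ k) r) atTop (𝓝 (p r)) := by
  have hlim : ∀ t, ∃ y ∈ K, Tendsto (fun k ↦ q k t) (hyperfilter ℕ : Filter ℕ) (𝓝 y) := fun t ↦
    hK.ultrafilter_le_nhds ((hyperfilter ℕ).map fun k ↦ q k t) <| by
      rw [le_principal_iff]
      exact Filter.mem_map.mpr (Filter.univ_mem' fun k ↦ hqK k t)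
  choose p hpK hp using hlim
  have hmono : Monotone p := fun s t hst ↦ le_of_tendsto_of_tendsto' (hp s) (hp t) fun k ↦ hq k hst
  have hclus : MapClusterPt (fun r : ℚ ↦ p r) atTop (fun k (r : ℚ) ↦ q k r) := by
    have h1 : Tendsto (fun k (r : ℚ) ↦ q k r) (hyperfilter ℕ : Filter ℕ)
        (𝓝 fun r : ℚ ↦ p r) := tendsto_pi_nhds.mpr fun r ↦ hp r
    exact h1.mapClusterPt.mono (by rw [← Nat.cofinite_eq_atTop]; exact hyperfilter_le_cofinite)
  obtain ⟨φ, hφ, h⟩ := hclus.tendsto_subseq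
  exact ⟨p, φ, hmono, hpK, hφ, fun r ↦ tendsto_pi_nhds.mp h r⟩

/-- If monotone functions converge on a dense set, they converge, uniformly under vanishing
shifts of the argument, at each point of continuity of the limit. -/
lemma tendsto_of_shift_le {q : ℕ → ℝ → ℝ} (hq : ∀ k, Monotone (q k)) {p : ℝ → ℝ}
    (h : ∀ r : ℚ, Tendsto (fun k ↦ q k r) atTop (𝓝 (p r))) {t : ℝ} (ht : ContinuousAt p t)
    {ε : ℕ → ℝ} (hε : Tendsto ε atTop (𝓝 0)) {y : ℕ → ℝ}
    (hy : ∀ᶠ k in atTop, q k (t - ε k) - ε k ≤ y k ∧ y k ≤ q k (t + ε k) + ε k) :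
    Tendsto y atTop (𝓝 (p t)) := by
  rw [Metric.tendsto_atTop']
  intro δ hδ
  obtain ⟨η, hη, hpη⟩ := Metric.continuousAt_iff.mp ht (δ / 3) (by positivity)
  obtain ⟨a, ha1, ha2⟩ := exists_rat_btwn (show t - η < t by linarith)
  obtain ⟨b, hb1, hb2⟩ := exists_rat_btwn (show t < t + η by linarith)
  have hpa := hpη (x := a) (by rw [Real.dist_eq, abs_lt]; constructor <;> linarith)
  have hpb := hpη (x := b) (by rw [Real.dist_eq, abs_lt]; constructor <;> linarith)
  rw [Real.dist_eq, abs_lt] at hpa hpb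
  have e1 := (h a).eventually (eventually_gt_nhds (show p a - δ / 3 < p a by linarith))
  have e2 := (h b).eventually (eventually_lt_nhds (show p b < p b + δ / 3 by linarith))
  have e3 := hε.eventually (eventually_lt_nhds (show (0 : ℝ) < min (δ / 3) (min (t - a) (b - t)) by
    simp only [lt_min_iff, sub_pos]; exact ⟨by positivity, ha2, hb1⟩))
  have key : ∀ᶠ k in atTop, dist (y k) (p t) < δ := by
    filter_upwards [e1, e2, e3, hy] with k h1 h2 h3 ⟨h4, h5⟩
    simp only [lt_min_iff] at h3
    have h6 := hq k (show (a : ℝ) ≤ t - ε k by linarith)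
    have h7 := hq k (show t + ε k ≤ (b : ℝ) by linarith)
    rw [Real.dist_eq, abs_lt]
    constructor <;> linarith
  obtain ⟨M, hM⟩ := eventually_atTop.mp key
  exact ⟨M, fun k hk ↦ hM k hk.le⟩

section Decomposable

variable {S T : Type*}

lemma pw_of_mem {E : Set S} {f g : S → T} {s : S} (hs : s ∈ E) : pw E g f s = g s := by
  simp [pw, hs]

lemma pw_of_notMem {E : Set S} {f g : S → T} {s : S} (hs : s ∉ E) : pw E g f s = f s := by
  simp [pw, hs]

variable [MeasurableSpace S]

lemma Decomposable.simpleFunc_mem {ι : Type*} {G : Set (S → T)} (hG : Decomposable G)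
    (hne : G.Nonempty) (g : ι → S → T) (φ : SimpleFunc S ι) (h : ∀ s, g (φ s) ∈ G) :
    (fun s ↦ g (φ s) s) ∈ G := by
  classical
  have key : ∀ Z : Finset ι, Z ⊆ φ.range → ∃ f ∈ G, ∀ s, φ s ∈ Z → f s = g (φ s) s := by
    intro Z
    induction Z using Finset.induction_on with
    | empty => exact fun _ ↦ hne.imp fun f hf ↦ ⟨hf, by simp⟩
    | insert z Z _ ih =>
      intro hZ
      obtain ⟨f, hf, hfs⟩ := ih ((Finset.subset_insert _ _).trans hZ)
      obtain ⟨s₀, hs₀⟩ := SimpleFunc.mem_range.mp (hZ (Finset.mem_insert_self _ _))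
      refine ⟨pw (φ ⁻¹' {z}) (g z) f, hG f hf _ (hs₀ ▸ h s₀) _ (φ.measurableSet_fiber z),
        fun s hs ↦ ?_⟩
      by_cases hz : φ s = z
      · rw [pw_of_mem (E := φ ⁻¹' {z}) hz, hz]
      · rw [pw_of_notMem (E := φ ⁻¹' {z}) hz]
        exact hfs s (Finset.mem_of_mem_insert_of_ne hs hz)
  obtain ⟨f, hf, hfs⟩ := key _ subset_rfl
  convert hf using 1
  ext s
  exact (hfs s (φ.mem_range_self s)).symm

variable [TopologicalSpace T]

/-- A sequentially closed decomposable set is stable under measurable choices among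
a continuous family of its elements. -/
lemma Decomposable.measurable_mem {G : Set (S → T)} (hG : Decomposable G) (hGc : IsSeqClosed G)
    {K : Set ℝ} (hK : K.Nonempty) {g : ℝ → S → T} (hg : ContinuousOn g K) (hgG : ∀ y ∈ K, g y ∈ G)
    {ψ : S → ℝ} (hψ : Measurable ψ) (hψK : ∀ s, ψ s ∈ K) : (fun s ↦ g (ψ s) s) ∈ G := by
  obtain ⟨y₀, hy₀⟩ := hK
  let φ : ℕ → SimpleFunc S ℝ := SimpleFunc.approxOn ψ hψ K y₀ hy₀
  have hφK : ∀ n s, φ n s ∈ K := SimpleFunc.approxOn_mem hψ hy₀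
  refine hGc (x := fun n s ↦ g (φ n s) s)
    (fun n ↦ hG.simpleFunc_mem ⟨_, hgG _ hy₀⟩ g (φ n) fun s ↦ hgG _ (hφK n s))
    (tendsto_pi_nhds.mpr fun s ↦ ?_)
  have h1 : Tendsto (fun n ↦ φ n s) atTop (𝓝[K] ψ s) :=
    tendsto_nhdsWithin_iff.mpr ⟨SimpleFunc.tendsto_approxOn hψ hy₀ (subset_closure (hψK s)),
      Eventually.of_forall fun n ↦ hφK n s⟩
  exact tendsto_pi_nhds.mp ((hg _ (hψK s)).tendsto.comp h1) s

lemma IsDecompSeqClosedGraph.isSeqClosed_val {μ : Measure S} {F : Set (S → T)}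
    {B : (S → T) → Set (S → T)} (hB : IsDecompSeqClosedGraph μ F B) {f : S → T} (hf : f ∈ F) :
    IsSeqClosed (B f) := fun v _ hv hvg ↦
  hB.seqClosed_graph (fun _ ↦ f) v f _ (fun _ ↦ hf) hv tendsto_const_nhds hvg hf
    (hB.seqClosed_dom (fun n ↦ hB.maps_into f hf (hv n)) hvg)

end Decomposable

/-- A nonempty compact metrizable set is parametrized by a nonempty compact set of reals. -/
lemma exists_real_parametrization {Y : Type*} [TopologicalSpace Y] {X : Set Y} (hX : X.Nonempty)
    (hXc : IsCompact X) (hXm : TopologicalSpace.MetrizableSpace X) :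
    ∃ (K : Set ℝ) (g : ℝ → Y), IsCompact K ∧ K.Nonempty ∧ ContinuousOn g K ∧ g '' K = X := by
  have : Nonempty X := hX.to_subtype
  have : CompactSpace X := isCompact_iff_compactSpace.mp hXc
  let := TopologicalSpace.metrizableSpaceMetric X
  obtain ⟨π, hπ, hπs⟩ := exists_nat_bool_continuous_surjective_of_compact X
  let ρ : cantorSet → Y := fun y ↦ π (cantorSetHomeomorphNatToBool y)
  have hρ : Continuous ρ :=
    continuous_subtype_val.comp (hπ.comp cantorSetHomeomorphNatToBool.continuous)
  let g : ℝ → Y := Function.extend Subtype.val ρ fun _ ↦ hX.some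
  have hgρ : ∀ y : cantorSet, g y = ρ y := fun y ↦
    Subtype.val_injective.extend_apply ρ (fun _ ↦ hX.some) y
  refine ⟨cantorSet, g, isCompact_cantorSet, ⟨0, zero_mem_cantorSet⟩, ?_, ?_⟩
  · rw [continuousOn_iff_continuous_domRestrict]
    convert hρ using 1
    ext1 y
    exact hgρ y
  · ext x
    constructor
    · rintro ⟨y, hy, rfl⟩
      rw [hgρ ⟨y, hy⟩]
      exact (π _).2
    · intro hx
      obtain ⟨w, hw⟩ := hπs ⟨x, hx⟩
      refine ⟨cantorSetHomeomorphNatToBool.symm w, Subtype.prop _, ?_⟩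
      rw [hgρ]
      simp [ρ, hw]

/-- If `B : F ⇉ F` is a decomposable μ-sequentially closed-graphed mapping and there
is a nonempty compact metrizable (in the topology of pointwise convergence) set
`X ⊆ F` with `X ∩ B f ≠ ∅` for every `f ∈ F`, then `B` has a fixed point. -/
theorem stmt1 {S T : Type*} [MeasurableSpace S] [TopologicalSpace T] [Nonempty T]
    (μ : Measure S) [IsProbabilityMeasure μ] (hμ : MeasureAtomless μ)
    (F : Set (S → T)) (B : (S → T) → Set (S → T))
    (hB : IsDecompSeqClosedGraph μ F B)
    (X : Set (S → T)) (hXne : X.Nonempty) (hXF : X ⊆ F)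
    (hXcompact : IsCompact X) (hXmetr : TopologicalSpace.MetrizableSpace X)
    (hXB : ∀ f ∈ F, (X ∩ B f).Nonempty) :
    ∃ f ∈ F, f ∈ B f := by
  obtain ⟨K, g, hK, hKne, hg, hgX⟩ := exists_real_parametrization hXne hXcompact hXmetr
  obtain ⟨U, hU, hU01, hUμ⟩ := hμ.exists_measurable_null_fibres
  have hgF : ∀ y ∈ K, g y ∈ F := fun y hy ↦ hXF (hgX ▸ Set.mem_image_of_mem g hy)
  let f : (ℝ → ℝ) → S → T := fun q s ↦ g (q (U s)) s
  have hfF : ∀ q : ℝ → ℝ, Monotone q → (∀ t, q t ∈ K) → f q ∈ F := fun q hq hqK ↦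
    hB.decomp_dom.measurable_mem hB.seqClosed_dom hKne hg hgF (hq.measurable.comp hU)
      fun s ↦ hqK _
  have hP : ∀ q : ℝ → ℝ, Monotone q → (∀ t, q t ∈ K) → ∃ y ∈ K, g y ∈ B (f q) := by
    intro q hq hqK
    obtain ⟨x, hxX, hxB⟩ := hXB _ (hfF q hq hqK)
    rw [← hgX] at hxX
    obtain ⟨y, hy, rfl⟩ := hxX
    exact ⟨y, hy, hxB⟩
  let ε : ℕ → ℝ := fun k ↦ 1 / ((k : ℝ) + 1)
  have hεpos : ∀ k, 0 < ε k := fun k ↦ Nat.one_div_pos_of_nat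
  have hε : Tendsto ε atTop (𝓝 0) := tendsto_one_div_add_atTop_nhds_zero_nat
  choose q hqmono hqK hq using fun k ↦
    exists_monotone_approx hK hKne (fun q y ↦ g y ∈ B (f q)) hP (hεpos k)
  obtain ⟨p, φ, hp, hpK, hφ, hlim⟩ := exists_subseq_tendsto_of_monotone hK hqmono hqK
  have hεφ : Tendsto (ε ∘ φ) atTop (𝓝 0) := hε.comp hφ.tendsto_atTop
  have hfp := hfF p hp hpK
  let E : Set S := U ⁻¹' {t | ¬ ContinuousAt p t}
  have hDc : {t | ¬ ContinuousAt p t}.Countable := hp.countable_not_continuousAt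
  have hEm : MeasurableSet E := hU hDc.measurableSet
  have hE0 : μ E = 0 := by
    have : E = ⋃ t ∈ {t | ¬ ContinuousAt p t}, U ⁻¹' {t} := by
      rw [← Set.preimage_iUnion₂, Set.biUnion_of_singleton]
    rw [this, measure_biUnion_null_iff hDc]
    exact fun t _ ↦ hUμ t
  have hsmall : ∀ t : ℝ, 0 < t → t < 1 → ∀ᶠ k in atTop, ε (φ k) < t ∧ t + ε (φ k) < 1 := by
    intro t h0 h1
    have := hεφ.eventually (eventually_lt_nhds (show (0 : ℝ) < min t (1 - t) by
      simp only [lt_min_iff, sub_pos]; exact ⟨h0, h1⟩))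
    filter_upwards [this] with k hk
    simp only [lt_min_iff, Function.comp] at hk
    exact ⟨hk.1, by linarith⟩
  have hconv : ∀ M t, ContinuousAt p t → ∀ y : ℕ → ℝ, (∀ k, y k ∈ K) →
      (∀ᶠ k in atTop, q (φ (k + M)) (t - ε (φ (k + M))) - ε (φ (k + M)) ≤ y k ∧
        y k ≤ q (φ (k + M)) (t + ε (φ (k + M))) + ε (φ (k + M))) →
      Tendsto (fun k ↦ g (y k)) atTop (𝓝 (g (p t))) := by
    intro M t ht y hyK hy
    have h1 : Tendsto y atTop (𝓝 (p t)) :=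
      tendsto_of_shift_le (fun k ↦ hqmono (φ (k + M)))
        (fun r ↦ (hlim r).comp (tendsto_add_atTop_nat M)) ht
        (hεφ.comp (tendsto_add_atTop_nat M)) hy
    exact (hg _ (hpK t)).tendsto.comp
      (tendsto_nhdsWithin_iff.mpr ⟨h1, Eventually.of_forall hyK⟩)
  have hgB : ∀ t, ContinuousAt p t → 0 < t → t < 1 → g (p t) ∈ B (f p) := by
    intro t ht h0 h1
    obtain ⟨M, hM⟩ := eventually_atTop.mp (hsmall t h0 h1)
    choose r hrmono hrK hr y hyK hry hy using fun k ↦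
      hq (φ (k + M)) t h0 (hM (k + M) (by omega)).2
    have hrF := fun k ↦ hfF (r k) (hrmono k) (hrK k)
    refine hB.seqClosed_graph (fun k ↦ pw E (f p) (f (r k))) (fun k ↦ g (y k)) _ _
      (fun k ↦ hB.decomp_dom _ (hrF k) _ hfp _ hEm)
      (fun k ↦ (hB.null_modification E hEm hE0 _ (hrF k) _ (hry k) _ hfp).2)
      (tendsto_pi_nhds.mpr fun s ↦ ?_) ?_ hfp (hgF _ (hpK t))
    · by_cases hs : s ∈ E
      · simp only [pw_of_mem hs]
        exact tendsto_const_nhds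
      · simp only [pw_of_notMem hs]
        refine tendsto_pi_nhds.mp (hconv M (U s) (not_not.mp hs) (fun k ↦ r k (U s))
          (fun k ↦ hrK k _) ?_) s
        filter_upwards [(tendsto_add_atTop_nat M).eventually (hsmall _ (hU01 s).1 (hU01 s).2)]
          with k hk
        have h2 := hr k (U s) hk.1 hk.2
        have h3 := hεpos (φ (k + M))
        constructor <;> linarith
    · refine hconv M t ht y hyK (Eventually.of_forall fun k ↦ ⟨le_trans ?_ (hy k).1, (hy k).2⟩)
      gcongr
      exact hqmono _ (sub_le_self _ (hεpos _).le)
  obtain ⟨y₀, hy₀K, hy₀⟩ := hP p hp hpK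
  classical
  have hψ : Measurable (E.piecewise (fun _ ↦ y₀) fun s ↦ p (U s)) :=
    measurable_const.piecewise hEm (hp.measurable.comp hU)
  have hmem := (hB.decomp_val _ hfp).measurable_mem (hB.isSeqClosed_val hfp)
    (K := {y ∈ K | g y ∈ B (f p)}) ⟨y₀, hy₀K, hy₀⟩ (hg.mono fun _ h ↦ h.1) (fun _ h ↦ h.2) hψ
    (fun s ↦ by
      by_cases hs : s ∈ E
      · rw [Set.piecewise_eq_of_mem _ _ _ hs]
        exact ⟨hy₀K, hy₀⟩
      · rw [Set.piecewise_eq_of_notMem _ _ _ hs]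
        exact ⟨hpK _, hgB _ (not_not.mp hs) (hU01 s).1 (hU01 s).2⟩)
  have hmod := (hB.null_modification E hEm hE0 _ hfp _ hmem _ hfp).1
  refine ⟨f p, hfp, ?_⟩
  convert hmod using 1
  ext s
  by_cases hs : s ∈ E
  · rw [pw_of_mem hs]
  · rw [pw_of_notMem hs, Set.piecewise_eq_of_notMem _ _ _ hs]
end

section
/- Let (S,Σ,μ) be an atomless probability space. Then there exists a measurable function r: S → [0,1] such that μ(r⁻¹(E)) = 0 for every Borel set E ⊆ [0,1] of Lebesgue measure zero. -/
open MeasureTheory Topology Filter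

/-- `A` is contained in `B` and has strictly smaller measure. -/
def MeasureSSubset {S : Type*} [MeasurableSpace S] (μ : Measure S)
    (A B : {A : Set S // MeasurableSet A}) : Prop :=
  (A : Set S) ⊆ B ∧ μ A < μ B

/-- A nonempty set in a first-countable complete linear order has a countable cofinal subset. -/
theorem exists_seq_cofinal {α : Type*} [CompleteLinearOrder α] [TopologicalSpace α]
    [OrderTopology α] [FirstCountableTopology α] {s : Set α} (hs : s.Nonempty) :
    ∃ u : ℕ → α, (∀ n, u n ∈ s) ∧ ∀ x ∈ s, ∃ n, x ≤ u n := by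
  obtain ⟨u, -, hu, hus⟩ := exists_seq_tendsto_sSup hs (OrderTop.bddAbove s)
  by_cases hmax : sSup s ∈ s
  · exact ⟨fun _ => sSup s, fun _ => hmax, fun x hx => ⟨0, le_sSup hx⟩⟩
  · refine ⟨u, hus, fun x hx => ?_⟩
    have hlt : x < sSup s := (le_sSup hx).lt_of_ne fun h => hmax (h ▸ hx)
    exact ((hu.eventually_const_lt hlt).exists).imp fun _ h => h.le

section MaxChain

variable {S : Type*} [MeasurableSpace S] {μ : Measure S}
  {C : Set {A : Set S // MeasurableSet A}}

theorem IsChain.subset_of_measure_le (hC : IsChain (MeasureSSubset μ) C)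
    {A B : {A : Set S // MeasurableSet A}} (hA : A ∈ C) (hB : B ∈ C) (h : μ A ≤ μ B) :
    (A : Set S) ⊆ B := by
  by_cases hAB : A = B
  · rw [hAB]
  · exact (hC hA hB hAB).elim (fun h' => h'.1) fun h' => absurd h'.2 h.not_gt

theorem IsMaxChain.mem_of_forall_measureSSubset (hC : IsMaxChain (MeasureSSubset μ) C)
    {X : {A : Set S // MeasurableSet A}}
    (hX : ∀ B ∈ C, MeasureSSubset μ B X ∨ MeasureSSubset μ X B) : X ∈ C := by
  have h := hC.2 (hC.1.insert fun B hB _ => (hX B hB).symm) (Set.subset_insert X C)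
  rw [h]
  exact Set.mem_insert X C

/-- The members of a chain of measure at most `t` have an upper bound of measure at most `t`
that is contained in every larger member of the chain. -/
theorem IsChain.exists_measurable_superset_measure_le (hC : IsChain (MeasureSSubset μ) C)
    (t : ENNReal) :
    ∃ U : Set S, MeasurableSet U ∧ μ U ≤ t ∧ (∀ B ∈ C, μ B ≤ t → (B : Set S) ⊆ U) ∧
      ∀ V : Set S, (∀ B ∈ C, μ B ≤ t → (B : Set S) ⊆ V) → U ⊆ V := by
  obtain hL | hL := ((fun B : {A : Set S // MeasurableSet A} => μ B) ''
    {B | B ∈ C ∧ μ B ≤ t}).eq_empty_or_nonempty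
  · rw [Set.image_eq_empty] at hL
    refine ⟨∅, MeasurableSet.empty, by simp, fun B hB hBt => ?_, fun V _ => Set.empty_subset V⟩
    exact absurd (show B ∈ {B | B ∈ C ∧ μ B ≤ t} from ⟨hB, hBt⟩) (by simp [hL])
  · obtain ⟨u, hu, hcof⟩ := exists_seq_cofinal hL
    choose A hA hAu using hu
    refine ⟨⋃ n, (A n : Set S), MeasurableSet.iUnion fun n => (A n).2, ?_, fun B hB hBt => ?_,
      fun V hV => Set.iUnion_subset fun n => hV _ (hA n).1 (hA n).2⟩
    · rw [Directed.measure_iUnion]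
      · exact iSup_le fun n => (hA n).2
      · intro m n
        obtain h | h := le_total (μ (A m)) (μ (A n))
        · exact ⟨n, hC.subset_of_measure_le (hA m).1 (hA n).1 h, subset_rfl⟩
        · exact ⟨m, subset_rfl, hC.subset_of_measure_le (hA n).1 (hA m).1 h⟩
    · obtain ⟨n, hn⟩ := hcof (μ B) ⟨B, ⟨hB, hBt⟩, rfl⟩
      rw [← hAu n] at hn
      exact (hC.subset_of_measure_le hB (hA n).1 hn).trans
        (Set.subset_iUnion (fun n => (A n : Set S)) n)

/-- The members of a chain of measure greater than `t` have a lower bound of measure at least `t`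
that contains every set contained in all of them. -/
theorem IsChain.exists_measurable_subset_le_measure [IsProbabilityMeasure μ]
    (hC : IsChain (MeasureSSubset μ) C) {t : ENNReal} (ht : t ≤ 1) :
    ∃ V : Set S, MeasurableSet V ∧ t ≤ μ V ∧ (∀ B ∈ C, t < μ B → V ⊆ (B : Set S)) ∧
      ∀ U : Set S, (∀ B ∈ C, t < μ B → U ⊆ (B : Set S)) → U ⊆ V := by
  obtain hL | hL := ((fun B : {A : Set S // MeasurableSet A} => OrderDual.toDual (μ B)) ''
    {B | B ∈ C ∧ t < μ B}).eq_empty_or_nonempty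
  · rw [Set.image_eq_empty] at hL
    refine ⟨Set.univ, MeasurableSet.univ, by simpa using ht, fun B hB hBt => ?_,
      fun U _ => Set.subset_univ U⟩
    exact absurd (show B ∈ {B | B ∈ C ∧ t < μ B} from ⟨hB, hBt⟩) (by simp [hL])
  · obtain ⟨u, hu, hcof⟩ := exists_seq_cofinal hL
    choose A hA hAu using hu
    refine ⟨⋂ n, (A n : Set S), MeasurableSet.iInter fun n => (A n).2, ?_, fun B hB hBt => ?_,
      fun U hU => Set.subset_iInter fun n => hU _ (hA n).1 (hA n).2⟩
    · rw [Directed.measure_iInter (fun n => (A n).2.nullMeasurableSet) _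
        ⟨0, measure_ne_top μ _⟩]
      · exact le_iInf fun n => (hA n).2.le
      · intro m n
        obtain h | h := le_total (μ (A m)) (μ (A n))
        · exact ⟨m, subset_rfl, hC.subset_of_measure_le (hA m).1 (hA n).1 h⟩
        · exact ⟨n, hC.subset_of_measure_le (hA n).1 (hA m).1 h, subset_rfl⟩
    · obtain ⟨n, hn⟩ := hcof (OrderDual.toDual (μ B)) ⟨B, ⟨hB, hBt⟩, rfl⟩
      rw [← hAu n] at hn
      exact (Set.iInter_subset (fun n => (A n : Set S)) n).trans
        (hC.subset_of_measure_le (hA n).1 hB hn)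

/-- A maximal chain in an atomless probability space contains sets of every measure in `[0,1]`. -/
theorem IsMaxChain.exists_measure_eq [IsProbabilityMeasure μ] (hμ : MeasureAtomless μ)
    (hC : IsMaxChain (MeasureSSubset μ) C) {t : ENNReal} (ht : t ≤ 1) :
    ∃ A ∈ C, μ A = t := by
  obtain ⟨U, hUm, hUt, hLU, hUmin⟩ := hC.1.exists_measurable_superset_measure_le t
  obtain ⟨V, hVm, htV, hVL, hVmax⟩ := hC.1.exists_measurable_subset_le_measure ht
  have hUV : U ⊆ V := hUmin V fun A hA hAt => hVmax A fun B hB hBt =>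
    hC.1.subset_of_measure_le hA hB (hAt.trans hBt.le)
  have hVU : μ V ≤ μ U := by
    by_contra! hlt
    have hdiff : μ (V \ U) = μ V - μ U :=
      measure_sdiff hUV hUm.nullMeasurableSet (measure_ne_top μ U)
    obtain ⟨F, hFsub, hFm, hF0, hFlt⟩ := hμ (V \ U) (hVm.diff hUm)
      (by rw [hdiff]; exact tsub_pos_of_lt hlt)
    have hX : μ (U ∪ F) = μ U + μ F :=
      measure_union (Set.disjoint_sdiff_right.mono_right hFsub) hFm
    have hUX : μ U < μ (U ∪ F) := by
      rw [hX]
      exact ENNReal.lt_add_right (measure_ne_top μ U) hF0.ne'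
    have hXV : μ (U ∪ F) < μ V := by
      rw [hX, add_comm]
      rw [hdiff] at hFlt
      exact lt_tsub_iff_right.1 hFlt
    have hXmem : (⟨U ∪ F, hUm.union hFm⟩ : {A : Set S // MeasurableSet A}) ∈ C := by
      refine hC.mem_of_forall_measureSSubset fun B hB => ?_
      obtain h | h := le_or_gt (μ B) t
      · have hBU := hLU B hB h
        exact Or.inl ⟨hBU.trans Set.subset_union_left, (measure_mono hBU).trans_lt hUX⟩
      · have hVB := hVL B hB h
        exact Or.inr ⟨(Set.union_subset hUV (hFsub.trans Set.sdiff_subset)).trans hVB,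
          hXV.trans_le (measure_mono hVB)⟩
    obtain h | h := le_or_gt (μ (U ∪ F)) t
    · exact hUX.not_ge (measure_mono (hLU _ hXmem h))
    · exact hXV.not_ge (measure_mono (hVL _ hXmem h))
  have hU : μ U = t := le_antisymm hUt (htV.trans hVU)
  by_contra! hne
  refine hne ⟨U, hUm⟩ (hC.mem_of_forall_measureSSubset fun B hB => ?_) hU
  obtain h | h := le_or_gt (μ B) t
  · exact Or.inl ⟨hLU B hB h, (h.lt_of_ne (hne B hB)).trans_eq hU.symm⟩
  · exact Or.inr ⟨hUV.trans (hVL B hB h), hU.trans_lt h⟩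

end MaxChain

/-- An atomless probability space has an increasing family of measurable sets, indexed by `ℝ`,
in which the set with index `x` has measure the projection of `x` to `[0,1]`. -/
theorem MeasureAtomless.exists_monotone_measure_eq {S : Type*} [MeasurableSpace S]
    {μ : Measure S} [IsProbabilityMeasure μ] (hμ : MeasureAtomless μ) :
    ∃ E : ℝ → Set S, (∀ x, MeasurableSet (E x)) ∧ Monotone E ∧
      ∀ x, μ (E x) = ENNReal.ofReal (max 0 (min x 1)) := by
  have hC := maxChain_spec (r := MeasureSSubset μ)
  have hle : ∀ x : ℝ, ENNReal.ofReal (max 0 (min x 1)) ≤ 1 := fun x => by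
    rw [ENNReal.ofReal_le_one]
    exact max_le zero_le_one (min_le_right x 1)
  choose E hEC hE using fun x : ℝ => hC.exists_measure_eq hμ (hle x)
  refine ⟨fun x => E x, fun x => (E x).2, fun x y hxy => ?_, hE⟩
  refine hC.1.subset_of_measure_le (hEC x) (hEC y) ?_
  rw [hE, hE]
  gcongr

/-- An atomless probability space carries a random variable that is uniform on `[0,1]`. -/
theorem MeasureAtomless.exists_map_eq_volume_restrict {S : Type*} [MeasurableSpace S]
    {μ : Measure S} [IsProbabilityMeasure μ] (hμ : MeasureAtomless μ) :
    ∃ r : S → ℝ, Measurable r ∧ (∀ s, r s ∈ Set.Icc (0 : ℝ) 1) ∧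
      μ.map r = volume.restrict (Set.Icc 0 1) := by
  classical
  obtain ⟨E, hEm, hEmono, hE⟩ := hμ.exists_monotone_measure_eq
  let f : ℚ → S → ℝ := fun q s => if s ∈ E q then max 0 (min (q : ℝ) 1) else 1
  have hf0 : ∀ q s, 0 ≤ f q s := fun q s => by
    dsimp only [f]
    split_ifs
    · exact le_max_left _ _
    · exact zero_le_one
  have hf1 : ∀ q s, f q s ≤ 1 := fun q s => by
    dsimp only [f]
    split_ifs
    · exact max_le zero_le_one (min_le_right _ _)
    · exact le_rfl
  have hbdd : ∀ s, BddBelow (Set.range fun q => f q s) := fun s =>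
    ⟨0, Set.forall_mem_range.2 fun q => hf0 q s⟩
  have hr : Measurable fun s => ⨅ q, f q s :=
    Measurable.iInf fun q => Measurable.ite (hEm q) measurable_const measurable_const
  refine ⟨fun s => ⨅ q, f q s, hr,
    fun s => ⟨le_ciInf fun q => hf0 q s, (ciInf_le (hbdd s) 0).trans (hf1 0 s)⟩, ?_⟩
  have : IsProbabilityMeasure (μ.map fun s => ⨅ q, f q s) :=
    Measure.isProbabilityMeasure_map hr.aemeasurable
  refine Measure.ext_of_Iic _ _ fun t => ?_
  have hvol : volume.restrict (Set.Icc (0 : ℝ) 1) (Set.Iic t) =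
      ENNReal.ofReal (max 0 (min t 1)) := by
    have hinter : Set.Iic t ∩ Set.Icc 0 1 = Set.Icc 0 (min t 1) := by
      ext x
      simp only [Set.mem_inter_iff, Set.mem_Iic, Set.mem_Icc, le_min_iff]
      tauto
    rw [Measure.restrict_apply measurableSet_Iic, hinter, Real.volume_Icc, sub_zero]
    simp [ENNReal.ofReal_max]
  rw [hvol, Measure.map_apply hr measurableSet_Iic]
  have hcont : Continuous fun x : ℝ => ENNReal.ofReal (max 0 (min x 1)) :=
    ENNReal.continuous_ofReal.comp (by fun_prop)
  apply le_antisymm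
  · refine ge_of_tendsto (hcont.continuousWithinAt (s := Set.Ioi t) (x := t)) ?_
    filter_upwards [self_mem_nhdsWithin] with x hx
    rw [Set.mem_Ioi] at hx
    rw [← hE]
    obtain hx1 | hx1 := le_or_gt x 1
    · refine measure_mono fun s hs => ?_
      obtain ⟨q, hq⟩ := exists_lt_of_ciInf_lt (lt_of_le_of_lt hs hx)
      dsimp only [f] at hq
      split_ifs at hq with hsq
      · refine hEmono ?_ hsq
        by_contra! hxq
        exact hq.not_ge (le_max_of_le_right (le_min hxq.le hx1))
      · exact absurd hx1 hq.not_ge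
    · rw [hE, min_eq_right hx1.le, max_eq_right zero_le_one, ENNReal.ofReal_one]
      exact prob_le_one
  · refine le_of_tendsto (hcont.continuousWithinAt (s := Set.Iio t) (x := t)) ?_
    filter_upwards [self_mem_nhdsWithin] with x hx
    obtain ⟨q, hxq, hqt⟩ := exists_rat_btwn (Set.mem_Iio.1 hx)
    obtain hq0 | hq0 := lt_or_ge (q : ℝ) 0
    · rw [max_eq_left ((min_le_left _ _).trans (hxq.trans hq0).le), ENNReal.ofReal_zero]
      exact zero_le
    · rw [← hE]
      refine measure_mono fun s hs => (ciInf_le (hbdd s) q).trans ?_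
      dsimp only [f]
      rw [if_pos (hEmono hxq.le hs)]
      exact max_le (hq0.trans hqt.le) ((min_le_left _ _).trans hqt.le)

/-- On an atomless probability space there is a measurable map `r : S → [0,1]` such
that `μ (r⁻¹ E) = 0` for every Borel set `E ⊆ [0,1]` of Lebesgue measure zero. -/
theorem stmt4 {S : Type*} [MeasurableSpace S]
    (μ : Measure S) [IsProbabilityMeasure μ] (hμ : MeasureAtomless μ) :
    ∃ r : S → ℝ, Measurable r ∧ (∀ s, r s ∈ Set.Icc (0 : ℝ) 1) ∧
      ∀ E : Set ℝ, MeasurableSet E → volume E = 0 → μ (r ⁻¹' E) = 0 := by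
  obtain ⟨r, hr, hr01, hmap⟩ := hμ.exists_map_eq_volume_restrict
  refine ⟨r, hr, hr01, fun E hE hE0 => ?_⟩
  rw [← Measure.map_apply hr hE, hmap]
  exact Measure.absolutelyContinuous_of_le Measure.restrict_le_self hE0
end
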